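/- Let n ≥ 4 be an integer and suppose G is a bipartite graph with |V(G)| ≥ ⌊n/2⌋, |E(G)| > (|V(G)|/2)^{1 + 1/⌊n/4⌋} + (3/2)|V(G)|, and (|V(G)|/2)^{1/⌊n/4⌋} ≥ 2. Then G has two edge-disjoint cycles, each of length at most n/2, that have at least one vertex in common. -/

import Mathlib

open Finset in
/-- Jensen's inequality for `log`, applied to each of the sums over `A` with one term left out. -/
theorem card_mul_log_add_sum_log_le {α : Type*} [DecidableEq α] (A : Finset α) (hA : 2 ≤ #A)
    (g : α → ℝ) (hg : ∀ a ∈ A, 0 < g a) :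
    (#A : ℝ) * Real.log (#A - 1) + ∑ a ∈ A, Real.log (g a) ≤
      ∑ a ∈ A, Real.log (∑ b ∈ A.erase a, g b) := by
  have hA' : (2 : ℝ) ≤ #A := by exact_mod_cast hA
  have hn : (0 : ℝ) < #A - 1 := by linarith
  have hcard : ∀ a ∈ A, (#(A.erase a) : ℝ) = #A - 1 := fun a ha => by
    rw [card_erase_of_mem ha, Nat.cast_sub (by omega), Nat.cast_one]
  have key : ∀ a ∈ A, Real.log (#A - 1) + ∑ b ∈ A.erase a, (#A - 1 : ℝ)⁻¹ * Real.log (g b) ≤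
      Real.log (∑ b ∈ A.erase a, g b) := fun a ha => by
    have hJ := strictConcaveOn_log_Ioi.concaveOn.le_map_sum (t := A.erase a)
      (w := fun _ => (#A - 1 : ℝ)⁻¹) (p := g) (fun _ _ => by positivity)
      (by rw [sum_const, nsmul_eq_mul, hcard a ha, mul_inv_cancel₀ hn.ne'])
      (fun b hb => hg b (mem_of_mem_erase hb))
    simp only [smul_eq_mul] at hJ
    have hs : 0 < ∑ b ∈ A.erase a, g b :=
      sum_pos (fun b hb => hg b (mem_of_mem_erase hb))
        (card_pos.mp (by rw [card_erase_of_mem ha]; omega))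
    rw [← mul_sum _ g, Real.log_mul (by positivity) hs.ne', Real.log_inv] at hJ
    linarith
  refine le_trans (le_of_eq ?_) (sum_le_sum key)
  have hsum : ∀ a ∈ A, ∑ b ∈ A.erase a, (#A - 1 : ℝ)⁻¹ * Real.log (g b) =
      (#A - 1 : ℝ)⁻¹ * (∑ b ∈ A, Real.log (g b) - Real.log (g a)) := fun a ha => by
    rw [← mul_sum, ← add_sum_erase A _ ha, add_sub_cancel_left]
  rw [sum_add_distrib, sum_congr rfl hsum, ← mul_sum, sum_sub_distrib]
  simp only [sum_const, nsmul_eq_mul]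
  field_simp

/-- The tangent line at `c` bounds the function `y ↦ (y + 1) * log (y / c)` from below. -/
theorem tangent_le_add_one_mul_log_div {c y : ℝ} (hc : 1 ≤ c) (hy : 1 ≤ y) :
    (1 + 1 / c) * (y - c) ≤ (y + 1) * (Real.log y - Real.log c) := by
  set g : ℝ → ℝ := fun x => (x + 1) * (Real.log x - Real.log c) - (1 + 1 / c) * (x - c) with hgdef
  have hd : ∀ x : ℝ, 0 < x → HasDerivAt g
      ((Real.log x - Real.log c) + (x + 1) * (1 / x) - (1 + 1 / c)) x := fun x hx => by
    have h1 := ((hasDerivAt_id x).add_const 1).mul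
      ((Real.hasDerivAt_log hx.ne').sub_const (Real.log c))
    have h2 := ((hasDerivAt_id x).sub_const c).const_mul (1 + 1 / c)
    convert! h1.sub h2 using 1
    simp
  have hcont : ∀ a b : ℝ, 0 < a → ContinuousOn g (Set.Icc a b) := fun a b ha x hx =>
    (hd x (ha.trans_le hx.1)).continuousAt.continuousWithinAt
  have hgc : g c = 0 := by simp [hgdef]
  have hlog : ∀ a b : ℝ, 0 < a → 0 < b → (a - b) / a ≤ Real.log a - Real.log b := fun a b ha hb => by
    have := Real.log_le_sub_one_of_pos (div_pos hb ha)
    rw [Real.log_div hb.ne' ha.ne'] at this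
    have h3 : (a - b) / a = 1 - b / a := by field_simp
    linarith
  suffices 0 ≤ g y by simp only [hgdef] at this; linarith
  rcases le_total c y with h | h
  · have hmono : MonotoneOn g (Set.Icc c y) := by
      refine monotoneOn_of_deriv_nonneg (convex_Icc _ _) (hcont c y (by linarith))
        (fun x hx => ?_) (fun x hx => ?_)
      all_goals
        rw [interior_Icc] at hx
        have hx0 : 0 < x := by linarith [hx.1]
      · exact (hd x hx0).differentiableAt.differentiableWithinAt
      · rw [(hd x hx0).deriv]
        have h1 := hlog x c hx0 (by linarith)
        have h2 : (x - c) / x + (x + 1) * (1 / x) - (1 + 1 / c) = (x - c) * (c - 1) / (x * c) := by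
          field_simp; ring
        have h3 : 0 ≤ (x - c) * (c - 1) / (x * c) :=
          div_nonneg (mul_nonneg (by linarith [hx.1]) (by linarith)) (by positivity)
        linarith
    exact hgc ▸ hmono (Set.left_mem_Icc.2 h) (Set.right_mem_Icc.2 h) h
  · have hanti : AntitoneOn g (Set.Icc y c) := by
      refine antitoneOn_of_deriv_nonpos (convex_Icc _ _) (hcont y c (by linarith))
        (fun x hx => ?_) (fun x hx => ?_)
      all_goals
        rw [interior_Icc] at hx
        have hx0 : 0 < x := by linarith [hx.1]
      · exact (hd x hx0).differentiableAt.differentiableWithinAt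
      · rw [(hd x hx0).deriv]
        have h1 := hlog c x (by linarith) hx0
        have h2 : (c - x) / c - (x + 1) * (1 / x) + (1 + 1 / c) = (c - x) * (x - 1) / (x * c) := by
          field_simp; ring
        have h3 : 0 ≤ (c - x) * (x - 1) / (x * c) :=
          div_nonneg (mul_nonneg (by linarith [hx.2]) (by linarith [hx.1])) (by positivity)
        linarith
    exact hgc ▸ hanti (Set.left_mem_Icc.2 h) (Set.right_mem_Icc.2 h) h

namespace SimpleGraph

open Finset

variable {V : Type*} {G : SimpleGraph V}

/-- Paths with the same endpoints agree if they are short compared to all cycles. -/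
theorem Walk.IsPath.eq_of_length_add_le {ℓ : ℕ}
    (hg : ∀ v (c : G.Walk v v), c.IsCycle → ℓ < c.length) {u v : V} {p q : G.Walk u v}
    (hp : p.IsPath) (hq : q.IsPath) (h : p.length + q.length ≤ ℓ) : p = q := by
  by_contra hne
  obtain ⟨w, -, -, c, hc, hle⟩ := hp.exists_isCycle_length_le_add_of_ne hq hne
  have := hg w c hc
  omega

variable [Fintype V]

open Classical in
/-- The last vertices of the non-backtracking walks in `G` that start with the step from `u` to `v`
and continue for `i` more steps. -/
noncomputable def nonbacktrackingEnds (G : SimpleGraph V) : ℕ → V → V → Finset V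
  | 0, _, v => {v}
  | i + 1, u, v => ((G.neighborFinset v).erase u).biUnion (G.nonbacktrackingEnds i v)

theorem exists_isPath_of_mem_nonbacktrackingEnds {k : ℕ}
    (hg : ∀ v (c : G.Walk v v), c.IsCycle → 2 * k < c.length) {i : ℕ} (hi : i < k) {u v x : V}
    (h : G.Adj u v) (hx : x ∈ G.nonbacktrackingEnds i u v) :
    ∃ p : G.Walk v x, (Walk.cons h p).IsPath ∧ p.length = i := by
  classical
  induction i generalizing u v with
  | zero =>
    simp only [nonbacktrackingEnds, mem_singleton] at hx
    subst hx
    exact ⟨.nil, by simp [h.ne], rfl⟩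
  | succ i ih =>
    simp only [nonbacktrackingEnds, mem_biUnion, mem_erase, mem_neighborFinset] at hx
    obtain ⟨w, ⟨hwu, hvw⟩, hxw⟩ := hx
    obtain ⟨p, hp, hpl⟩ := ih (by omega) hvw hxw
    refine ⟨.cons hvw p, (Walk.cons_isPath_iff _ _).2 ⟨hp, fun hu => hwu ?_⟩, by simp [hpl]⟩
    have hle := (Walk.cons hvw p).length_takeUntil_le_length hu
    have heq : (Walk.cons hvw p).takeUntil u hu = .cons h.symm .nil := by
      refine (hp.takeUntil hu).eq_of_length_add_le hg (by simp [h.ne']) ?_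
      simp only [Walk.length_cons, Walk.length_nil] at hle ⊢
      omega
    have := (Walk.cons hvw p).getVert_length_takeUntil hu
    rw [heq] at this
    simpa using this

theorem card_nonbacktrackingEnds_succ [DecidableEq V] [DecidableRel G.Adj] {k : ℕ}
    (hg : ∀ v (c : G.Walk v v), c.IsCycle → 2 * k < c.length) {i : ℕ} (hi : i < k) (u v : V) :
    #(G.nonbacktrackingEnds (i + 1) u v) =
      ∑ w ∈ (G.neighborFinset v).erase u, #(G.nonbacktrackingEnds i v w) := by
  have hends : G.nonbacktrackingEnds (i + 1) u v =
      ((G.neighborFinset v).erase u).biUnion (G.nonbacktrackingEnds i v) := by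
    rw [nonbacktrackingEnds]
    congr!
  rw [hends, card_biUnion]
  intro w hw w' hw' hne
  simp only [mem_coe, mem_erase, mem_neighborFinset] at hw hw'
  rw [Function.onFun, Finset.disjoint_left]
  intro x hx hx'
  obtain ⟨p, hp, hpl⟩ := exists_isPath_of_mem_nonbacktrackingEnds hg hi hw.2 hx
  obtain ⟨q, hq, hql⟩ := exists_isPath_of_mem_nonbacktrackingEnds hg hi hw'.2 hx'
  have heq := hp.eq_of_length_add_le hg hq (by simp only [Walk.length_cons]; omega)
  exact hne (by simpa using congrArg Walk.snd heq)

theorem Coloring.eq_add_of_mem_nonbacktrackingEnds (C : G.Coloring (ZMod 2)) {i : ℕ} {u v x : V}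
    (hx : x ∈ G.nonbacktrackingEnds i u v) : C x = C v + i := by
  induction i generalizing u v with
  | zero => simp_all [nonbacktrackingEnds]
  | succ i ih =>
    simp only [nonbacktrackingEnds, mem_biUnion, mem_erase, mem_neighborFinset] at hx
    obtain ⟨w, ⟨-, hvw⟩, hxw⟩ := hx
    have hC := C.valid hvw
    rw [ih hxw, Nat.cast_succ]
    generalize C v = a at *
    generalize C w = b at *
    have : b = a + 1 := by revert a b; decide
    rw [this]; ring

theorem card_nonbacktrackingEnds_add_swap_le (hG : G.Colorable 2) (i : ℕ) {u v : V}
    (h : G.Adj u v) :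
    #(G.nonbacktrackingEnds i u v) + #(G.nonbacktrackingEnds i v u) ≤ Fintype.card V := by
  classical
  obtain ⟨C⟩ : Nonempty (G.Coloring (ZMod 2)) := hG
  rw [← card_union_of_disjoint]
  · exact card_le_univ _
  · rw [Finset.disjoint_left]
    intro x hx hx'
    refine C.valid h ?_
    have := (C.eq_add_of_mem_nonbacktrackingEnds hx).symm.trans
      (C.eq_add_of_mem_nonbacktrackingEnds hx')
    exact (add_right_cancel this).symm

theorem sum_sum_neighborFinset_comm [DecidableRel G.Adj] (f : V → V → ℝ) :
    ∑ v, ∑ w ∈ G.neighborFinset v, f v w = ∑ v, ∑ w ∈ G.neighborFinset v, f w v :=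
  Finset.sum_comm' (by simp [adj_comm])

/-- The entropy argument: if all degrees are at least two and there are no cycles of length at most
`2 * k`, then the numbers of non-backtracking walks are large on geometric average. -/
theorem mul_sum_degree_mul_log_le [DecidableRel G.Adj] {k : ℕ}
    (hg : ∀ v (c : G.Walk v v), c.IsCycle → 2 * k < c.length) (hdeg : ∀ v, 2 ≤ G.degree v)
    {i : ℕ} (hi : i ≤ k) :
    (∀ v, ∀ u ∈ G.neighborFinset v, 0 < #(G.nonbacktrackingEnds i u v)) ∧
    i * ∑ v, (G.degree v : ℝ) * Real.log (G.degree v - 1) ≤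
      ∑ v, ∑ u ∈ G.neighborFinset v, Real.log #(G.nonbacktrackingEnds i u v) := by
  classical
  induction i with
  | zero => simp [nonbacktrackingEnds]
  | succ i ih =>
    obtain ⟨hpos, hle⟩ := ih (by omega)
    have hpos' : ∀ v, ∀ w ∈ G.neighborFinset v, 0 < #(G.nonbacktrackingEnds i v w) :=
      fun v w hw => hpos w v (by simpa [adj_comm] using hw)
    have hsucc := card_nonbacktrackingEnds_succ hg (show i < k by omega)
    refine ⟨fun v u hu => ?_, ?_⟩
    · rw [hsucc]
      refine sum_pos (fun w hw => hpos' v w (mem_of_mem_erase hw)) (card_pos.1 ?_)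
      rw [card_erase_of_mem hu, card_neighborFinset_eq_degree]
      have := hdeg v
      omega
    · rw [sum_sum_neighborFinset_comm] at hle
      calc ((i + 1 : ℕ) : ℝ) * ∑ v, (G.degree v : ℝ) * Real.log (G.degree v - 1)
          ≤ ∑ v, (G.degree v : ℝ) * Real.log (G.degree v - 1) +
            ∑ v, ∑ w ∈ G.neighborFinset v, Real.log #(G.nonbacktrackingEnds i v w) := by
            push_cast; linarith
        _ ≤ _ := by
            rw [← sum_add_distrib]
            refine sum_le_sum fun v _ => ?_
            have := card_mul_log_add_sum_log_le (G.neighborFinset v) (by simpa using hdeg v)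
              (fun w => (#(G.nonbacktrackingEnds i v w) : ℝ))
              (fun w hw => by exact_mod_cast hpos' v w hw)
            rw [card_neighborFinset_eq_degree] at this
            refine this.trans (le_of_eq (sum_congr rfl fun u _ => ?_))
            rw [hsucc, Nat.cast_sum]

/-- The Moore bound for irregular bipartite graphs of minimum degree at least two. -/
theorem card_edgeFinset_le_of_two_le_degree [DecidableRel G.Adj] {k : ℕ} (hk : k ≠ 0)
    (hG : G.Colorable 2) (hg : ∀ v (c : G.Walk v v), c.IsCycle → 2 * k < c.length)
    (hdeg : ∀ v, 2 ≤ G.degree v) {c : ℝ} (hc : 1 ≤ c) (hcard : (Fintype.card V : ℝ) / 2 ≤ c ^ k) :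
    (#G.edgeFinset : ℝ) ≤ (c + 1) / 2 * Fintype.card V := by
  obtain ⟨hpos, hle⟩ := mul_sum_degree_mul_log_le hg hdeg le_rfl
  set f : V → V → ℝ := fun u v => Real.log #(G.nonbacktrackingEnds k u v) with hf
  have hdegsum : (∑ v, (G.degree v : ℝ)) = 2 * #G.edgeFinset := by
    exact_mod_cast G.sum_degrees_eq_twice_card_edges
  have hpair : ∀ v, ∀ u ∈ G.neighborFinset v, f u v + f v u ≤ 2 * (k * Real.log c) := by
    intro v u hu
    have huv : G.Adj v u := by simpa using hu
    have h1 : (0 : ℝ) < #(G.nonbacktrackingEnds k u v) := by exact_mod_cast hpos v u hu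
    have h2 : (0 : ℝ) < #(G.nonbacktrackingEnds k v u) := by
      exact_mod_cast hpos u v (by simpa using huv.symm)
    have h3 : (#(G.nonbacktrackingEnds k u v) : ℝ) + #(G.nonbacktrackingEnds k v u) ≤
        Fintype.card V := by
      exact_mod_cast card_nonbacktrackingEnds_add_swap_le hG k huv.symm
    simp only [hf]
    rw [← Real.log_mul h1.ne' h2.ne', ← Real.log_pow, ← Nat.cast_ofNat, ← Real.log_pow]
    refine Real.log_le_log (by positivity) ?_
    nlinarith [sq_nonneg ((#(G.nonbacktrackingEnds k u v) : ℝ) - #(G.nonbacktrackingEnds k v u)),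
      pow_pos (show 0 < c by linarith) k]
  have hupper : ∑ v, ∑ u ∈ G.neighborFinset v, f u v ≤
      (∑ v, (G.degree v : ℝ)) * (k * Real.log c) := by
    have hswap := sum_sum_neighborFinset_comm (G := G) f
    have : ∑ v, ∑ u ∈ G.neighborFinset v, (f u v + f v u) ≤
        ∑ v, ∑ u ∈ G.neighborFinset v, 2 * (k * Real.log c) :=
      sum_le_sum fun v _ => sum_le_sum (hpair v)
    simp only [sum_add_distrib, sum_const, card_neighborFinset_eq_degree, nsmul_eq_mul,
      ← sum_mul] at this
    linarith
  have hk0 : (0 : ℝ) < k := by positivity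
  have hlog : ∑ v, (G.degree v : ℝ) * (Real.log (G.degree v - 1) - Real.log c) ≤ 0 := by
    simp only [mul_sub, sum_sub_distrib, ← sum_mul]
    refine nonpos_of_mul_nonpos_right (a := (k : ℝ)) ?_ hk0
    linarith
  have htan : ∑ v, (1 + 1 / c) * ((G.degree v : ℝ) - 1 - c) ≤
      ∑ v, (G.degree v : ℝ) * (Real.log (G.degree v - 1) - Real.log c) := by
    refine sum_le_sum fun v _ => ?_
    have hd : (2 : ℝ) ≤ G.degree v := by exact_mod_cast hdeg v
    simpa using tangent_le_add_one_mul_log_div hc (show (1 : ℝ) ≤ G.degree v - 1 by linarith)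
  rw [← mul_sum] at htan
  have h0 : ∑ v, ((G.degree v : ℝ) - 1 - c) ≤ 0 :=
    nonpos_of_mul_nonpos_right (htan.trans hlog) (by positivity)
  simp only [sum_sub_distrib, sum_const, card_univ, nsmul_eq_mul, hdegsum] at h0
  linarith

/-- The Moore bound for irregular bipartite graphs. -/
theorem card_edgeFinset_le_of_forall_isCycle_lt_length {V : Type*} [Fintype V] (G : SimpleGraph V)
    [DecidableRel G.Adj] {k : ℕ} (hk : k ≠ 0)
    (hG : G.Colorable 2) (hg : ∀ v (c : G.Walk v v), c.IsCycle → 2 * k < c.length)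
    {c : ℝ} (hc : 1 ≤ c) (hcard : (Fintype.card V : ℝ) / 2 ≤ c ^ k) :
    (#G.edgeFinset : ℝ) ≤ (c + 1) / 2 * Fintype.card V := by
  classical
  induction hm : Fintype.card V generalizing V with
  | zero =>
    have := Fintype.card_eq_zero_iff.1 hm
    simp [Finset.eq_empty_of_isEmpty]
  | succ m ih =>
    by_cases hdeg : ∀ v, 2 ≤ G.degree v
    · exact hm ▸ card_edgeFinset_le_of_two_le_degree hk hG hg hdeg hc hcard
    push Not at hdeg
    obtain ⟨v, hv⟩ := hdeg
    have hcardv : Fintype.card ({v}ᶜ : Set V) = m := by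
      rw [Fintype.card_compl_set, hm]; simp
    have hinj : Function.Injective (Embedding.induce (G := G) ({v}ᶜ : Set V)).toHom :=
      (Embedding.induce (G := G) ({v}ᶜ : Set V)).injective
    have := ih (G.induce ({v}ᶜ : Set V)) (hG.of_hom (Embedding.induce _).toHom)
      (fun w p hp => (hg _ _ (hp.map hinj)).trans_eq (p.length_map _))
      (by rw [hcardv]; rw [hm] at hcard; push_cast at hcard; linarith) hcardv
    rw [card_edgeFinset_induce_compl_singleton, card_edgeFinset_deleteIncidenceSet] at this
    have hle : (#G.edgeFinset : ℝ) ≤ ((#G.edgeFinset - G.degree v : ℕ) : ℝ) + 1 := by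
      norm_cast; omega
    push_cast
    linarith

/-- If edge-disjoint cycles of length at most `ℓ` are vertex-disjoint, then deleting the edges of
such cycles one cycle at a time costs at most one edge for each vertex on such a cycle. -/
theorem ncard_edgeSet_le_add_ncard {ℓ B : ℕ} (G : SimpleGraph V)
    (hB : ∀ H ≤ G, (∀ v (c : H.Walk v v), c.IsCycle → ℓ < c.length) → H.edgeSet.ncard ≤ B)
    (hG : ∀ (u w : V) (c : G.Walk u u) (d : G.Walk w w), c.IsCycle → d.IsCycle → c.length ≤ ℓ →
      d.length ≤ ℓ → (∀ e ∈ c.edges, e ∉ d.edges) → ∀ z ∈ c.support, z ∉ d.support) :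
    G.edgeSet.ncard ≤
      B + {z | ∃ (u : V) (c : G.Walk u u), c.IsCycle ∧ c.length ≤ ℓ ∧ z ∈ c.support}.ncard := by
  classical
  induction hm : G.edgeSet.ncard using Nat.strong_induction_on generalizing G with
  | _ m ih =>
  by_cases hshort : ∀ v (c : G.Walk v v), c.IsCycle → ℓ < c.length
  · exact hm ▸ (hB G le_rfl hshort).trans (Nat.le_add_right _ _)
  push Not at hshort
  obtain ⟨v, c, hc, hcl⟩ := hshort
  set E : Set (Sym2 V) := {e | e ∈ c.edges} with hE
  set H := G.deleteEdges E with hH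
  have hHG : H ≤ G := deleteEdges_le E
  have hEcard : E.ncard = c.length := by
    rw [← c.length_edges, ← List.toFinset_card_of_nodup hc.edges_nodup, ← Set.ncard_coe_finset]
    congr 1; ext; simp [hE]
  have hSeq : {z | z ∈ c.support} = {z | z ∈ c.support.tail} := by
    ext z
    simp only [Set.mem_ofPred_eq]
    refine ⟨fun hz => ?_, List.mem_of_mem_tail⟩
    rw [Walk.mem_support_iff] at hz
    rcases hz with rfl | hz
    · exact Walk.end_mem_tail_support hc.not_nil
    · exact hz
  have hScard : {z | z ∈ c.support}.ncard = c.length := by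
    rw [hSeq]
    have : c.support.tail.length = c.length := by simp
    rw [← this, ← List.toFinset_card_of_nodup hc.support_nodup, ← Set.ncard_coe_finset]
    congr 1; ext; simp
  have hlen := hc.three_le_length
  have hHcard : H.edgeSet.ncard + c.length = G.edgeSet.ncard := by
    rw [hH, edgeSet_deleteEdges, ← hEcard]
    exact Set.ncard_sdiff_add_ncard_of_subset (fun e he => c.edges_subset_edgeSet he)
  have hstep := ih _ (by omega) H (fun H' hH' => hB H' (hH'.trans hHG))
    (fun u w c d hc hd hcl hdl hdisj z hz => by
      simpa using hG u w (c.mapLe hHG) (d.mapLe hHG) (hc.mapLe hHG) (hd.mapLe hHG) (by simpa)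
        (by simpa) (by simpa using hdisj) z (by simpa)) rfl
  have hsub : {z | ∃ (u : V) (c : H.Walk u u), c.IsCycle ∧ c.length ≤ ℓ ∧ z ∈ c.support} ∪
      {z | z ∈ c.support} ⊆
      {z | ∃ (u : V) (c : G.Walk u u), c.IsCycle ∧ c.length ≤ ℓ ∧ z ∈ c.support} := by
    rintro z (⟨u, d, hd, hdl, hz⟩ | hz)
    · exact ⟨u, d.mapLe hHG, hd.mapLe hHG, by simpa, by simpa⟩
    · exact ⟨v, c, hc, hcl, hz⟩
  have hdisj : Disjoint
      {z | ∃ (u : V) (c : H.Walk u u), c.IsCycle ∧ c.length ≤ ℓ ∧ z ∈ c.support}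
      {z | z ∈ c.support} := by
    rw [Set.disjoint_left]
    rintro z ⟨u, d, hd, hdl, hz⟩ hz'
    refine hG v u c (d.mapLe hHG) hc (hd.mapLe hHG) hcl (by simpa) (fun e he he' => ?_) z hz'
      (by simpa)
    have : e ∈ H.edgeSet := d.edges_subset_edgeSet (by simpa using he')
    rw [hH, edgeSet_deleteEdges] at this
    exact this.2 he
  have := Set.ncard_le_ncard hsub (Set.toFinite _)
  rw [Set.ncard_union_eq hdisj (Set.toFinite _) (Set.toFinite _), hScard] at this
  omega

end SimpleGraph


/-- Let `n ≥ 4` and suppose `G` is a bipartite graph with `|V(G)| ≥ ⌊n/2⌋`,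
`|E(G)| > (|V(G)|/2)^(1+1/⌊n/4⌋) + (3/2)|V(G)|`, and `(|V(G)|/2)^(1/⌊n/4⌋) ≥ 2`.
Then `G` has two edge-disjoint cycles, each of length at most `n/2`, having at
least one vertex in common. -/
theorem two_intersecting_short_cycles
    {V : Type*} [Fintype V] (G : SimpleGraph V) (n : ℕ) (hn : 4 ≤ n)
    (hbip : G.Colorable 2)
    (hV : (n / 2 : ℕ) ≤ Fintype.card V)
    (hE : ((Fintype.card V : ℝ) / 2) ^ ((1 : ℝ) + 1 / ((n / 4 : ℕ) : ℝ)) +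
      (3 / 2 : ℝ) * (Fintype.card V : ℝ) < (G.edgeSet.ncard : ℝ))
    (h2 : (2 : ℝ) ≤ ((Fintype.card V : ℝ) / 2) ^ ((1 : ℝ) / ((n / 4 : ℕ) : ℝ))) :
    ∃ (u w : V) (c1 : G.Walk u u) (c2 : G.Walk w w),
      c1.IsCycle ∧ c2.IsCycle ∧
      (c1.length : ℝ) ≤ (n : ℝ) / 2 ∧ (c2.length : ℝ) ≤ (n : ℝ) / 2 ∧
      (∀ e ∈ c1.edges, e ∉ c2.edges) ∧
      (∃ z : V, z ∈ c1.support ∧ z ∈ c2.support) := by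
  classical
  set N : ℝ := (Fintype.card V : ℝ) with hN
  set k : ℕ := n / 4 with hk
  have hk0 : k ≠ 0 := by omega
  have hk0' : (k : ℝ) ≠ 0 := by exact_mod_cast hk0
  have hNpos : 0 < N / 2 := by
    have : 0 < Fintype.card V := by omega
    positivity
  set c : ℝ := (N / 2) ^ ((1 : ℝ) / k) with hc
  have hck : c ^ k = N / 2 := by
    rw [hc, ← Real.rpow_natCast, ← Real.rpow_mul hNpos.le, one_div_mul_cancel hk0', Real.rpow_one]
  rw [Real.rpow_add hNpos, Real.rpow_one, ← hc] at hE
  by_contra hcon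
  push Not at hcon
  have hlen : ∀ l : ℕ, l ≤ 2 * k → (l : ℝ) ≤ (n : ℝ) / 2 := fun l hl => by
    have : l * 2 ≤ n := by omega
    have : (l : ℝ) * 2 ≤ n := by exact_mod_cast this
    linarith
  have hB : ∀ H ≤ G, (∀ v (p : H.Walk v v), p.IsCycle → 2 * k < p.length) →
      H.edgeSet.ncard ≤ ⌊(c + 1) / 2 * N⌋₊ := fun H hH hg => by
    refine Nat.le_floor ?_
    rw [← H.coe_edgeFinset, Set.ncard_coe_finset]
    exact H.card_edgeFinset_le_of_forall_isCycle_lt_length hk0 (hbip.mono_left hH) hg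
      (by linarith) hck.ge
  have hmain := G.ncard_edgeSet_le_add_ncard hB fun u w p q hp hq hpl hql =>
    hcon u w p q hp hq (hlen _ hpl) (hlen _ hql)
  have hle := hmain.trans (Nat.add_le_add_left (Set.ncard_le_card _) _)
  have hle' : (G.edgeSet.ncard : ℝ) ≤ ⌊(c + 1) / 2 * N⌋₊ + N := by
    rw [Nat.card_eq_fintype_card] at hle
    rw [hN, ← Nat.cast_add]
    exact Nat.cast_le.2 hle
  have hfloor := Nat.floor_le (show 0 ≤ (c + 1) / 2 * N from
    mul_nonneg (by linarith) (by linarith))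
  linarith
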